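/- For every infinite cardinal κ there exists a completely regular (Tychonoff) widely-connected topological space of cardinality 2^κ. -/

import Mathlib

universe u

/-- A topological space is widely-connected if it is connected and every
connected subset containing more than one point is dense. -/
def WidelyConnectedSpace (W : Type u) [TopologicalSpace W] : Prop :=
  ConnectedSpace W ∧ ∀ A : Set W, A.Nontrivial → IsPreconnected A → Dense A


namespace WC

open Set Order Topology

structure Pt (I : Type u) : Type u where
  t : unitInterval
  s : I → Bool

noncomputable def sg (b : Bool) : ℝ := if b then 1 else -1

lemma sg_ne (b : Bool) : sg b ≠ 0 := by cases b <;> simp [sg]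

section
variable {I : Type u} [LinearOrder I] [SuccOrder I]

open Classical in
noncomputable def a (η : I) : Pt I :=
  ⟨if IsMin η then 0 else 1, fun ζ => decide (¬ (succ ζ = η ∨ IsSuccLimit η))⟩

def b : Pt I := ⟨1, fun _ => true⟩

inductive F : Set I → (Pt I → ℝ) → Prop
  | base (D : Set I) : F D (fun y => (y.t : ℝ))
  | step (D : Set I) (γ : I) (f : Pt I → ℝ) (hγ : γ ∈ D) (hf : F (Iio γ) f) :
      F D (fun y => sg (y.s γ) * (f y - f (a γ)))

lemma F_mono {D D' : Set I} (h : D ⊆ D') {f : Pt I → ℝ} (hf : F D f) : F D' f := by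
  cases hf with
  | base => exact F.base _
  | step _ γ f hγ hf => exact F.step _ γ f (h hγ) hf

lemma F_dep {D : Set I} {f : Pt I → ℝ} (hf : F D f) (hD : IsLowerSet D) {y y' : Pt I}
    (ht : y.t = y'.t) (hs : ∀ β ∈ D, y.s β = y'.s β) : f y = f y' := by
  induction hf with
  | base => simp [ht]
  | step D γ f hγ hf ih =>
    have := ih (isLowerSet_Iio γ) (fun β hβ => hs β (hD (le_of_lt hβ) hγ))
    simp only [this, hs γ hγ]

def Sp (_D : Set I) : Type u := Pt I

def ev (D : Set I) (y : Sp D) (f : {f : Pt I → ℝ // F D f}) : ℝ := f.1 y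

instance (D : Set I) : TopologicalSpace (Sp D) := TopologicalSpace.induced (ev D) inferInstance

lemma ev_ind (D : Set I) : IsInducing (ev D) := ⟨rfl⟩

lemma cont_F {D : Set I} {f : Pt I → ℝ} (hf : F D f) : Continuous (X := Sp D) f :=
  (continuous_apply (⟨f, hf⟩ : {f : Pt I → ℝ // F D f})).comp (ev_ind D).continuous

lemma cont_to {Z : Type*} [TopologicalSpace Z] {D : Set I} {g : Z → Sp D}
    (h : ∀ f : Pt I → ℝ, F D f → Continuous (fun z => f (g z))) : Continuous g := by
  rw [(ev_ind D).continuous_iff]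
  exact continuous_pi fun f => h f.1 f.2

def Eqv (D : Set I) (y y' : Pt I) : Prop := ∀ f, F D f → f y = f y'

lemma Eqv.symm {D : Set I} {y y' : Pt I} (h : Eqv D y y') : Eqv D y' y :=
  fun f hf => (h f hf).symm

lemma Eqv.trans {D : Set I} {y y' y'' : Pt I} (h : Eqv D y y') (h' : Eqv D y' y'') :
    Eqv D y y'' := fun f hf => (h f hf).trans (h' f hf)

lemma Eqv.mono {D D' : Set I} (hD : D' ⊆ D) {y y' : Pt I} (h : Eqv D y y') :
    Eqv D' y y' := fun f hf => h f (F_mono hD hf)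

lemma Eqv.open_iff {D : Set I} {y y' : Pt I} (h : Eqv D y y') {O : Set (Pt I)}
    (hO : IsOpen (X := Sp D) O) : y ∈ O ↔ y' ∈ O := by
  have : Inseparable (X := Sp D) y y' := by
    refine (ev_ind D).inseparable_iff.1 ?_
    have : ev D y = ev D y' := by funext f; exact h f.1 f.2
    rw [this]
  exact this.mem_open_iff hO

lemma eqv_of {D : Set I} (hD : IsLowerSet D) {y y' : Pt I}
    (ht : y.t = y'.t) (hs : ∀ β ∈ D, y.s β = y'.s β) : Eqv D y y' :=
  fun _ hf => F_dep hf hD ht hs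

lemma a_t {η : I} (h : ¬ IsMin η) : (a η).t = 1 := by simp [a, h]

lemma a_succ_eqv [NoMaxOrder I] {β η : I} (h : β ≤ η) : Eqv (Iio β) (a (succ η)) b := by
  apply eqv_of (isLowerSet_Iio β)
  · rw [a_t]; rfl
    exact not_isMin_of_lt (lt_succ η)
  · intro ζ hζ
    have h1 : succ ζ ≠ succ η := by
      intro h'; exact absurd (succ_injective h') (ne_of_lt (lt_of_lt_of_le hζ h))
    have h2 : ¬ IsSuccLimit (succ η) := not_isSuccLimit_succ η
    simp [a, b, h2]
    intro h; exact absurd (by rw [h]) h1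

lemma b_ne_a [NoMaxOrder I] [WellFoundedLT I] (η : I) :
    ∃ f, F (Iio η) f ∧ f (b : Pt I) ≠ f (a η) := by
  induction η using SuccOrder.limitRecOn with
  | isMin η h => exact ⟨_, F.base _, by simp [a, b, h]⟩
  | succ η h ih =>
    obtain ⟨f, hf, hne⟩ := ih
    refine ⟨_, F.step _ η f (lt_succ η) hf, ?_⟩
    have h1 : f (a (succ η)) = f b := a_succ_eqv le_rfl f hf
    have h2 : (a (succ η)).s η = false := by simp [a]
    have h3 : (b : Pt I).s η = true := rfl
    simp only [h1, h2, h3, sg]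
    intro h
    apply hne
    simp at h
    linarith
  | isSuccLimit η h ih =>
    obtain ⟨ζ, hζ⟩ := not_isMin_iff.1 h.not_isMin
    obtain ⟨f, hf, hne⟩ := ih ζ hζ
    by_cases h0 : f (a η) = f b
    · refine ⟨_, F.step _ ζ f hζ hf, ?_⟩
      have h2 : (a η).s ζ = false := by simp [a, h]
      have h3 : (b : Pt I).s ζ = true := rfl
      simp only [h0, h2, h3, sg]
      intro h
      apply hne
      simp at h
      linarith
    · exact ⟨f, F_mono (Iio_subset_Iio hζ.le) hf, fun h => h0 h.symm⟩

/-- crossing -/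
lemma cross {D : Set I} {A : Set (Pt I)} (hA : IsPreconnected (α := Sp D) A) {γ : I}
    (hγ : γ ∈ D) (hD : Iio γ ⊆ D) {x y : Pt I} (hx : x ∈ A) (hy : y ∈ A)
    (hxy : x.s γ ≠ y.s γ) : ∃ z ∈ A, Eqv (Iio γ) z (a γ) := by
  by_contra hcon
  push Not at hcon
  have key : ∀ c : Bool, IsOpen (X := Sp D)
      {z : Pt I | z.s γ = c ∧ ¬ Eqv (Iio γ) z (a γ)} := by
    intro c
    have : {z : Pt I | z.s γ = c ∧ ¬ Eqv (Iio γ) z (a γ)} =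
        ⋃ f : {f : Pt I → ℝ // F (Iio γ) f},
          {z : Pt I | 0 < (sg (z.s γ) * (f.1 z - f.1 (a γ))) * (sg c * (f.1 z - f.1 (a γ)))} := by
      ext z
      simp only [mem_ofPred_eq, mem_iUnion, Eqv, not_forall]
      constructor
      · rintro ⟨h1, f, hf, h2⟩
        refine ⟨⟨f, hf⟩, ?_⟩
        rw [h1]
        have : sg c * (f z - f (a γ)) ≠ 0 := mul_ne_zero (sg_ne c) (sub_ne_zero.2 h2)
        exact mul_self_pos.2 this
      · rintro ⟨⟨f, hf⟩, h⟩
        refine ⟨?_, f, hf, ?_⟩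
        · by_contra hne
          have : sg (z.s γ) = - sg c := by
            revert hne; cases z.s γ <;> cases c <;> simp [sg]
          rw [this] at h
          dsimp only at h
          nlinarith [sq_nonneg (sg c * (f z - f (a γ)))]
        · intro h'
          simp [h'] at h
    refine this ▸ isOpen_iUnion (X := Sp D) fun f => ?_
    have h1 := cont_F (F.step D γ f.1 hγ f.2)
    have h2 := cont_F (F_mono hD f.2)
    exact isOpen_lt continuous_const (h1.mul (continuous_const.mul (h2.sub continuous_const)))
  obtain ⟨z, -, ⟨h1, -⟩, ⟨h2, -⟩⟩ := hA _ _ (key (x.s γ)) (key (y.s γ)) (by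
    intro z hz
    have : z.s γ = x.s γ ∨ z.s γ = y.s γ := by
      revert hxy; cases z.s γ <;> cases x.s γ <;> cases y.s γ <;> simp
    rcases this with h | h
    · exact Or.inl ⟨h, hcon z hz⟩
    · exact Or.inr ⟨h, hcon z hz⟩) ⟨x, hx, rfl, hcon x hx⟩ ⟨y, hy, rfl, hcon y hy⟩
  exact hxy (h1.symm.trans h2)

def j (η : I) (x y : Pt I) : Pt I := ⟨y.t, fun β => if β < η then y.s β else x.s β⟩

lemma cont_j (η : I) (x : Pt I) (D : Set I) :
    Continuous (X := Sp (Iio η)) (Y := Sp D) (j η x) := by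
  apply cont_to
  intro f hf
  induction hf with
  | base D => exact cont_F (F.base (Iio η))
  | step D γ f hγ hf ih =>
    by_cases h : γ < η
    · have := cont_F (F.step (Iio η) γ f h hf)
      refine (continuous_congr fun y => ?_).2 this
      have h1 : f (j η x y) = f y := F_dep hf (isLowerSet_Iio γ) rfl (by
        intro β hβ
        have : β < η := lt_trans hβ h
        simp [j, this])
      have h2 : (j η x y).s γ = Pt.s y γ := by simp [j, h]
      change sg ((j η x y).s γ) * (f (j η x y) - f (a γ)) = _
      exact congrArg₂ (fun p q => sg p * (q - f (a γ))) h2 h1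
    · simp only [j, h, if_false]
      exact continuous_const.mul (ih.sub continuous_const)

lemma j_eqv (η : I) (x y : Pt I) : Eqv (Iio η) (j η x y) y :=
  eqv_of (isLowerSet_Iio η) rfl (fun β hβ => by simp [j, mem_Iio.1 hβ])

lemma id_cont {D D' : Set I} (h : D' ⊆ D) :
    Continuous (X := Sp D) (Y := Sp D') (fun y => y) :=
  cont_to fun _ hf => cont_F (F_mono h hf)

lemma open_mono {D D' : Set I} (h : D' ⊆ D) {O : Set (Pt I)} (hO : IsOpen (X := Sp D') O) :
    IsOpen (X := Sp D) O := IsOpen.preimage (X := Sp D) (Y := Sp D') (id_cont h) hO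

lemma dense_mono {D D' : Set I} (h : D' ⊆ D) {A : Set (Pt I)} (hA : Dense (X := Sp D) A) :
    Dense (X := Sp D') A := by
  replace hA := dense_iff_inter_open.1 hA
  refine dense_iff_inter_open.2 ?_
  intro O hO hne
  exact hA O (open_mono h hO) hne

lemma pre_mono {D D' : Set I} (h : D' ⊆ D) {A : Set (Pt I)}
    (hA : IsPreconnected (α := Sp D) A) : IsPreconnected (α := Sp D') A := by
  intro U V hU hV
  exact hA U V (open_mono h hU) (open_mono h hV)

/-- limit sets -/
structure Lim (D : Set I) : Prop where
  lower : IsLowerSet D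
  ne : D.Nonempty
  succ : ∀ β ∈ D, succ β ∈ D

lemma Lim.nh [NoMaxOrder I] {D : Set I} (h : Lim D) {O : Set (Pt I)}
    (hO : IsOpen (X := Sp D) O) {w : Pt I} (hw : w ∈ O) :
    ∃ η ∈ D, ∃ V : Set (Pt I), IsOpen (X := Sp (Iio η)) V ∧ w ∈ V ∧ V ⊆ O := by
  have hmem : O ∈ @nhds (Sp D) _ w := hO.mem_nhds hw
  have hle : (⨅ η : D, @nhds (Sp (Iio η.1)) _ w) ≤ @nhds (Sp D) _ w := by
    have e : ∀ w : Sp D, 𝓝 w = ⨅ f : {f : Pt I → ℝ // F D f},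
        Filter.comap (fun y : Sp D => f.1 y) (𝓝 (f.1 w)) := by
      intro w
      rw [(ev_ind D).nhds_eq_comap, nhds_pi, Filter.pi, Filter.comap_iInf]
      refine iInf_congr fun f => ?_
      rw [Filter.comap_comap]
      rfl
    refine le_of_le_of_eq ?_ (e w).symm
    refine le_iInf fun f => ?_
    have : ∃ η : D, F (Iio η.1) f.1 := by
      obtain ⟨f, hf⟩ := f
      cases hf with
      | base => obtain ⟨η, hη⟩ := h.ne; exact ⟨⟨η, hη⟩, F.base _⟩
      | step _ γ f hγ hf => exact ⟨⟨_, h.succ γ hγ⟩, F.step _ γ f (lt_succ γ) hf⟩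
    obtain ⟨η, hη⟩ := this
    refine iInf_le_of_le η ?_
    exact ((cont_F hη).tendsto w).le_comap
  have h2 := hle hmem
  have : Nonempty D := h.ne.to_subtype
  have h2 := (Filter.mem_iInf_of_directed (α := Pt I) ?_ O).1 h2
  · obtain ⟨η, hη⟩ := h2
    obtain ⟨V, h1, h2, h3⟩ := mem_nhds_iff.1 hη
    exact ⟨η.1, η.2, V, h2, h3, h1⟩
  · apply directed_of_isDirected_le
    intro η η' hle s hs
    obtain ⟨V, h1, h2, h3⟩ := mem_nhds_iff.1 hs
    exact mem_nhds_iff.2 ⟨V, h1, open_mono (Iio_subset_Iio (show η.1 ≤ η'.1 from hle)) h2, h3⟩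

lemma Lim.dense [NoMaxOrder I] {D : Set I} (h : Lim D) {A : Set (Pt I)}
    (hA : ∀ η ∈ D, Dense (X := Sp (Iio η)) A) : Dense (X := Sp D) A := by
  refine dense_iff_inter_open.2 ?_
  rintro O hO ⟨w, hw⟩
  obtain ⟨η, hη, V, hV, hwV, hVO⟩ := h.nh hO hw
  obtain ⟨z, hz, hzA⟩ := dense_iff_inter_open.1 (hA η hη) V hV ⟨w, hwV⟩
  exact ⟨z, hVO hz, hzA⟩

lemma lim_Iio [NoMaxOrder I] {l : I} (h : IsSuccLimit l) : Lim (Iio l) :=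
  ⟨isLowerSet_Iio l, not_isMin_iff.1 h.not_isMin, fun _ hβ => h.isSuccPrelimit.succ_lt hβ⟩

lemma lim_univ [NoMaxOrder I] [Nonempty I] : Lim (univ : Set I) :=
  ⟨isLowerSet_univ, univ_nonempty, fun _ _ => mem_univ _⟩

def E (D : Set I) (x : Pt I) : Set (Pt I) := ⋃ η : D, range (j η.1 x)

lemma E_conn {D : Set I} (x : Pt I)
    (hc : ∀ η ∈ D, IsPreconnected (α := Sp (Iio η)) univ) :
    IsPreconnected (α := Sp D) (E D x) := by
  apply isPreconnected_iUnion (α := Sp D)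
  · refine ⟨x, mem_iInter.2 fun η => ⟨x, ?_⟩⟩
    simp [j]
  · intro η
    have := (hc η.1 η.2).image _ (cont_j η.1 x D).continuousOn
    exact (image_univ (f := j η.1 x)) ▸ this

lemma E_dense [NoMaxOrder I] {D : Set I} (h : Lim D) (x : Pt I) :
    Dense (X := Sp D) (E D x) := by
  apply h.dense
  intro η hη
  refine dense_iff_inter_open.2 ?_
  rintro O hO ⟨w, hw⟩
  exact ⟨j η x w, ((j_eqv η x w).open_iff hO).2 hw, mem_iUnion.2 ⟨⟨η, hη⟩, w, rfl⟩⟩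

lemma eqv_succ [NoMaxOrder I] {η : I} {y y' : Pt I} (h : Eqv (Iio η) y (a η))
    (h' : Eqv (Iio η) y' (a η)) : Eqv (Iio (succ η)) y y' := by
  intro f hf
  cases hf with
  | base => exact (h _ (F.base _)).trans (h' _ (F.base _)).symm
  | step _ γ f hγ hf =>
    rcases (lt_succ_iff.1 hγ).lt_or_eq with h1 | rfl
    · exact (h _ (F.step _ γ f h1 hf)).trans (h' _ (F.step _ γ f h1 hf)).symm
    · simp [h f hf, h' f hf]

lemma conn [NoMaxOrder I] [WellFoundedLT I] (η : I) :
    IsPreconnected (α := Sp (Iio η)) univ := by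
  induction η using SuccOrder.limitRecOn with
  | isMin η h =>
    have hind : IsInducing (X := Sp (Iio η)) (fun y => (Pt.t y : unitInterval)) := by
      constructor
      apply le_antisymm
      · rw [← continuous_iff_le_induced]
        exact Continuous.subtype_mk (cont_F (F.base (Iio η))) _
      · let _ : TopologicalSpace (Pt I) := TopologicalSpace.induced (fun y => y.t) inferInstance
        have : Continuous (X := Pt I) (Y := Sp (Iio η)) (fun y => y) := by
          apply cont_to
          intro f hf
          cases hf with
          | base => exact continuous_subtype_val.comp continuous_induced_dom
          | step _ γ f hγ hf => exact absurd hγ (h.not_lt)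
        exact continuous_id_iff_le.1 this
    rw [← hind.isPreconnected_image]
    have : (fun y : Sp (Iio η) => (Pt.t y : unitInterval)) '' univ = univ := by
      rw [image_univ, range_eq_univ]
      intro t
      exact ⟨⟨t, fun _ => true⟩, rfl⟩
    rw [this]
    exact isPreconnected_univ
  | succ η h ih =>
    have h1 : ∀ c : Bool, IsPreconnected (α := Sp (Iio (succ η)))
        (closure (X := Sp (Iio (succ η))) (range (j η ⟨0, fun _ => c⟩))) := by
      intro c
      have := ih.image _ (cont_j η ⟨0, fun _ => c⟩ (Iio (succ η))).continuousOn
      have h2 : IsPreconnected (α := Sp (Iio (succ η))) (range (j η ⟨0, fun _ => c⟩)) :=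
        (image_univ (f := j η ⟨0, fun _ => c⟩)) ▸ this
      exact h2.closure
    have hcl : ∀ (c : Bool) (y : Pt I) (y' : Pt I), Eqv (Iio (succ η)) (j η ⟨0, fun _ => c⟩ y) y' →
        y' ∈ closure (X := Sp (Iio (succ η))) (range (j η ⟨0, fun _ => c⟩)) := by
      intro c y y' h
      apply (mem_closure_iff (X := Sp (Iio (succ η)))).2
      intro O hO hy'
      exact ⟨_, (h.open_iff hO).2 hy', y, rfl⟩
    have := IsPreconnected.union (α := Sp (Iio (succ η))) (a η)
      (hcl true (a η) (a η) (eqv_succ (j_eqv _ _ _) (fun _ _ => rfl)))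
      (hcl false (a η) (a η) (eqv_succ (j_eqv _ _ _) (fun _ _ => rfl))) (h1 true) (h1 false)
    refine Eq.mp ?_ this
    congr 1
    refine eq_univ_of_forall (α := Pt I) ?_
    intro y
    have hh : y ∈ closure (X := Sp (Iio (succ η))) (range (j η ⟨0, fun _ => Pt.s y η⟩)) := by
      apply hcl (Pt.s y η) y y
      refine eqv_of (isLowerSet_Iio _) (y := j η ⟨0, fun _ => Pt.s y η⟩ y) (y' := y) rfl ?_
      intro β hβ
      rcases (lt_succ_iff.1 hβ).lt_or_eq with h1 | rfl
      · simp [j, h1]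
      · simp [j]
    cases hc : Pt.s y η
    · rw [hc] at hh; exact Or.inr hh
    · rw [hc] at hh; exact Or.inl hh
  | isSuccLimit η h ih =>
    have h1 := (E_conn (D := Iio η) b ih).closure
    rwa [(E_dense (lim_Iio h) b).closure_eq] at h1

open Classical in
noncomputable def r (η : I) (c : Bool) (y : Pt I) : Pt I := if y.s η = c then y else a η

lemma cont_r {D : Set I} (η : I) (c : Bool) (hη : η ∈ D) (hD : Iio η ⊆ D) :
    Continuous (X := Sp D) (Y := Sp (Iio η)) (r η c) := by
  apply cont_to
  intro f hf
  have h1 := cont_F (F.step D η f hη hf)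
  have h2 := cont_F (F_mono hD hf)
  have : (fun z : Sp D => f (r η c z)) = fun z : Sp D =>
      f (a η) + ((f z - f (a η)) + sg c * (sg (Pt.s z η) * (f z - f (a η)))) / 2 := by
    funext z
    unfold r
    cases c <;> cases hz : Pt.s z η <;> simp [sg]
  rw [this]
  exact continuous_const.add
    (((h2.sub continuous_const).add (continuous_const.mul h1)).div_const 2)

lemma b_sign [NoMaxOrder I] [WellFoundedLT I] {D : Set I} {η : I} (hη : η ∈ D) (hD : Iio η ⊆ D)
    {z : Pt I} (hz : Eqv D z b) : z.s η = true := by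
  obtain ⟨f, hf, hne⟩ := b_ne_a η
  have h1 := hz _ (F.step D η f hη hf)
  have h2 := hz _ (F_mono hD hf)
  by_contra h
  have h' : z.s η = false := by simpa using h
  have h3 : (b : Pt I).s η = true := rfl
  simp only [h2, h', h3, sg] at h1
  apply hne
  simp at h1
  linarith

lemma irr [NoMaxOrder I] [WellFoundedLT I] (γ : I) : ∀ (B : Set (Pt I)),
    IsPreconnected (α := Sp (Iio γ)) B → ∀ y ∈ B, ∀ z ∈ B, Eqv (Iio γ) y (a γ) →
      Eqv (Iio γ) z b → Dense (X := Sp (Iio γ)) B := by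
  induction γ using SuccOrder.limitRecOn with
  | isMin γ h =>
    intro B hB y hy z hz hya hzb
    have hy0 : (y.t : ℝ) = 0 := by
      have := hya _ (F.base _); simpa [a, h] using this
    have hz0 : (z.t : ℝ) = 1 := by
      have := hzb _ (F.base _); simpa [b] using this
    refine dense_iff_inter_open.2 ?_
    rintro O hO ⟨w, hw⟩
    have himg := hB.image _ (cont_F (F.base (Iio γ))).continuousOn
    have hw' : (w.t : ℝ) ∈ (fun y : Sp (Iio γ) => ((Pt.t y : unitInterval) : ℝ)) '' B := by
      apply himg.ordConnected.out ⟨y, hy, rfl⟩ ⟨z, hz, rfl⟩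
      change (w.t : ℝ) ∈ Icc (y.t : ℝ) z.t
      rw [hy0, hz0]; exact w.t.2
    obtain ⟨x, hx, hxw⟩ := hw'
    refine ⟨x, ?_, hx⟩
    have : Eqv (Iio γ) x w := by
      intro f hf
      cases hf with
      | base => exact hxw
      | step _ γ' f hγ hf => exact absurd hγ (h.not_lt)
    exact (this.open_iff hO).2 hw
  | succ η hmax ih =>
    intro B hB y hy z hz hya hzb
    have hsub : Iio η ⊆ Iio (succ η) := Iio_subset_Iio (le_succ η)
    have hzs : z.s η = true := b_sign (D := Iio (succ η)) (lt_succ η) hsub hzb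
    have hys : y.s η = false := by
      obtain ⟨f, hf, hne⟩ := b_ne_a η
      have h1 := hya _ (F.step _ η f (lt_succ η) hf)
      have h2 := hya _ (F_mono hsub hf)
      have h4 : f (a (succ η)) = f b := a_succ_eqv le_rfl f hf
      by_contra h
      have h' : y.s η = true := by simpa using h
      have h3 : (a (succ η)).s η = false := by simp [a]
      simp only [h2, h', h3, h4, sg] at h1
      apply hne
      simp at h1
      linarith
    obtain ⟨x, hx, hxa⟩ := cross hB (lt_succ η) hsub hy hz (by simp [hzs, hys])
    have hd : ∀ c, Dense (X := Sp (Iio η)) (r η c '' B) := by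
      intro c
      have hp := hB.image _ (cont_r (D := Iio (succ η)) η c (lt_succ η) hsub).continuousOn
      cases c
      · refine ih _ hp (a η) ⟨z, hz, by simp [r, hzs]; rfl⟩ y ⟨y, hy, by simp [r, hys]; rfl⟩
          (fun _ _ => rfl) ?_
        exact (hya.mono hsub).trans (a_succ_eqv le_rfl)
      · exact ih _ hp (a η) ⟨y, hy, by simp [r, hys]; rfl⟩ z ⟨z, hz, by simp [r, hzs]; rfl⟩
          (fun _ _ => rfl) (hzb.mono hsub)
    refine dense_iff_inter_open.2 ?_
    rintro O hO ⟨w, hw⟩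
    by_cases hwa : Eqv (Iio η) w (a η)
    · exact ⟨x, ((eqv_succ hxa hwa).open_iff hO).2 hw, hx⟩
    have hwa' := hwa
    unfold Eqv at hwa'
    push Not at hwa'
    obtain ⟨f, hf, hfne⟩ := hwa'
    have hjy : ∀ y : Pt I, y.s η = w.s η → Eqv (Iio (succ η)) (j η w y) y := by
      intro y h
      refine eqv_of (isLowerSet_Iio _) (y := j η w y) (y' := y) rfl ?_
      intro β hβ
      rcases (lt_succ_iff.1 hβ).lt_or_eq with h1 | rfl
      · simp [j, h1]
      · simp [j, h]
    have hV : IsOpen (X := Sp (Iio η)) ((j η w ⁻¹' O) ∩ {y | f y ≠ f (a η)}) :=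
      (hO.preimage (cont_j η w _)).inter (isOpen_ne_fun (cont_F hf) continuous_const)
    obtain ⟨q, ⟨hq1, hq2⟩, p, hp, rfl⟩ := dense_iff_inter_open.1 (hd (w.s η)) _ hV
      ⟨w, ((hjy w rfl).open_iff hO).2 hw, hfne⟩
    by_cases hps : p.s η = w.s η
    · have hrp : r η (w.s η) p = p := by simp [r, hps]
      rw [hrp] at hq1
      exact ⟨p, ((hjy p hps).open_iff hO).1 hq1, hp⟩
    · have hrp : r η (w.s η) p = a η := by simp [r, hps]
      rw [hrp] at hq2
      exact absurd rfl hq2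
  | isSuccLimit l hl ih =>
    intro B hB y hy z hz hya hzb
    apply (lim_Iio hl).dense
    intro η hη
    have hsub : Iio η ⊆ Iio l := Iio_subset_Iio (le_of_lt hη)
    have hzs : z.s η = true := b_sign hη hsub hzb
    have hB' := pre_mono hsub hB
    have hcr : ∃ x ∈ B, Eqv (Iio η) x (a η) := by
      by_cases h : y.s η = true
      · refine ⟨y, hy, fun f hf => ?_⟩
        have h1 := hya _ (F.step _ η f hη hf)
        have h2 := hya _ (F_mono hsub hf)
        have h3 : (a l).s η = false := by simp [a, hl]
        simp only [h2, h, h3, sg] at h1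
        rw [h2]
        simp at h1
        linarith
      · exact cross hB hη hsub hy hz (by rw [hzs]; exact h)
    obtain ⟨x, hx, hxa⟩ := hcr
    exact ih η hη B hB' x hx z hz hxa (hzb.mono hsub)

def Rel (x y : Pt I) : Prop := ∃ α : I, ∀ β ≥ α, x.s (succ β) = y.s (succ β)

lemma rel_of_nondense [NoMaxOrder I] [WellFoundedLT I] [Nonempty I] {A : Set (Pt I)}
    (hA : IsPreconnected (α := Sp (univ : Set I)) A)
    (hd : ¬ Dense (X := Sp (univ : Set I)) A) {x y : Pt I} (hx : x ∈ A) (hy : y ∈ A) :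
    Rel x y := by
  have : ∃ α : I, ¬ Dense (X := Sp (Iio α)) A := by
    by_contra h
    push Not at h
    exact hd (lim_univ.dense fun η _ => h η)
  obtain ⟨α, hα⟩ := this
  have key : ∀ β ξ : I, α ≤ β → β ≤ ξ → (∃ z ∈ A, Eqv (Iio β) z (a β)) →
      (∃ z ∈ A, Eqv (Iio (succ ξ)) z (a (succ ξ))) → False := by
    rintro β ξ h1 h2 ⟨z, hz, hza⟩ ⟨z', hz', hza'⟩
    apply hα
    apply dense_mono (Iio_subset_Iio h1)
    refine irr β A (pre_mono (subset_univ _) hA) z hz z' hz' hza ?_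
    exact (hza'.mono (Iio_subset_Iio (h2.trans (le_succ ξ)))).trans (a_succ_eqv h2)
  have : ∃ α' : I, ∀ β ≥ α', ¬ ∃ z ∈ A, Eqv (Iio (succ β)) z (a (succ β)) := by
    by_cases h : ∃ β ≥ α, ∃ z ∈ A, Eqv (Iio (succ β)) z (a (succ β))
    · obtain ⟨β, hβ, h⟩ := h
      exact ⟨succ β, fun ξ hξ h' => key (succ β) ξ (hβ.le.trans (le_succ β)) hξ h h'⟩
    · push Not at h
      exact ⟨α, fun β hβ ⟨z, hz, hz'⟩ => h β hβ z hz hz'⟩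
  obtain ⟨α', h'⟩ := this
  refine ⟨α', fun β hβ => ?_⟩
  by_contra hne
  exact h' β hβ (cross hA (mem_univ _) (subset_univ _) hx hy hne)

lemma E_rel [NoMaxOrder I] {x y : Pt I} (h : y ∈ E (univ : Set I) x) : Rel x y := by
  obtain ⟨η, w, rfl⟩ := mem_iUnion.1 h
  refine ⟨η.1, fun β hβ => ?_⟩
  have : ¬ succ β < η.1 := not_lt.2 (hβ.le.trans (le_succ β))
  simp [j, this]

end

open Cardinal in
lemma opens_card {Y ι : Type u} [TopologicalSpace Y] (e : Y → ι → ℝ) (he : IsInducing e)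
    {κ : Cardinal.{u}} (hκ : ℵ₀ ≤ κ) (hι : #ι ≤ κ) :
    #(TopologicalSpace.Opens Y) ≤ 2 ^ κ := by
  let N := List (ι × ℚ × ℚ)
  let B : N → Set Y := fun n => {y | ∀ p ∈ n, e y p.1 ∈ Ioo (p.2.1 : ℝ) (p.2.2 : ℝ)}
  have hB : ∀ (U : Set Y), IsOpen U → ∀ y ∈ U, ∃ n, y ∈ B n ∧ B n ⊆ U := by
    intro U hU y hy
    have hb := (isTopologicalBasis_pi (fun _ : ι => Real.isTopologicalBasis_Ioo_rat)).isInducing he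
    obtain ⟨_, ⟨_, ⟨V, S, hV, rfl⟩, rfl⟩, hyS, hsub⟩ := hb.exists_subset_of_mem_open hy hU
    have hV' : ∀ i : S, ∃ p : ℚ × ℚ, V i.1 = Ioo (p.1 : ℝ) (p.2 : ℝ) := by
      intro i
      have := hV i.1 i.2
      simp only [mem_iUnion, mem_singleton_iff] at this
      obtain ⟨p, q, -, h⟩ := this
      exact ⟨(p, q), h⟩
    choose p hp using hV'
    refine ⟨S.attach.toList.map fun i => (i.1, p i), ?_, ?_⟩
    · intro q hq
      obtain ⟨i, -, rfl⟩ := List.mem_map.1 hq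
      have := hyS i.1 i.2
      rw [hp i] at this
      exact this
    · intro z hz
      apply hsub
      intro i hi
      rw [hp ⟨i, hi⟩]
      exact hz (i, p ⟨i, hi⟩) (List.mem_map.2 ⟨⟨i, hi⟩, by simp, rfl⟩)
  have hinj : Function.Injective
      (fun U : TopologicalSpace.Opens Y => {n : N | B n ⊆ (U : Set Y)}) := by
    have key : ∀ U V : TopologicalSpace.Opens Y,
        {n : N | B n ⊆ (U : Set Y)} = {n : N | B n ⊆ (V : Set Y)} → U ≤ V := by
      intro U V h y hy
      obtain ⟨n, h1, h2⟩ := hB U U.2 y hy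
      have : n ∈ {n : N | B n ⊆ (V : Set Y)} := h ▸ h2
      exact this h1
    exact fun U V h => le_antisymm (key U V h) (key V U h.symm)
  refine (mk_le_of_injective hinj).trans ?_
  rw [mk_set]
  refine power_le_power_left two_ne_zero ?_
  refine (mk_list_le_max _).trans (max_le hκ ?_)
  rw [mk_prod]
  simp only [lift_uzero, mk_prod]
  refine (mul_le_max_of_aleph0_le_right ?_).trans ?_
  · simp
  · simpa using ⟨hι, hκ⟩

theorem core {Y J : Type u} [TopologicalSpace Y] [CompletelyRegularSpace Y] [Nonempty J]
    (K : J → Set Y) (hKc : ∀ g, IsPreconnected (K g)) (hKd : ∀ g, Dense (K g))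
    (hK : ∀ g g', g ≠ g' → ∀ y ∈ K g, ∀ y' ∈ K g', ∀ A, IsPreconnected A → y ∈ A → y' ∈ A →
      Dense A)
    (k : J → Set Y × Set Y) (hk : ∀ U V, IsOpen U → IsOpen V → ∃ g, k g = (U, V))
    (φ : Y → ℝ) (hφ : Continuous φ) (p q : Y) (hpq : φ p ≠ φ q) :
    ∃ _ : TopologicalSpace J, T35Space J ∧ WidelyConnectedSpace J := by
  have hw : ∀ g, ∃ y ∈ K g, IsOpen (k g).1 → IsOpen (k g).2 → (k g).1.Nonempty →
      (k g).2.Nonempty → Disjoint (k g).1 (k g).2 → y ∉ (k g).1 ∪ (k g).2 := by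
    intro g
    by_contra! h
    have hne : (K g).Nonempty := by
      have : Nonempty Y := ⟨p⟩
      exact (hKd g).nonempty
    obtain ⟨y, hy⟩ := hne
    obtain ⟨h1, h2, h3, h4, h5, -⟩ := h y hy
    have hc : K g ⊆ (k g).1 ∪ (k g).2 := fun z hz => (h z hz).2.2.2.2.2
    obtain ⟨z, -, hz1, hz2⟩ := hKc g _ _ h1 h2 hc
      (by rw [inter_comm]; exact (hKd g).inter_open_nonempty _ h1 h3)
      (by rw [inter_comm]; exact (hKd g).inter_open_nonempty _ h2 h4)
    exact disjoint_left.1 h5 hz1 hz2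
  choose w hwK hw using hw
  have hw' : ∀ U V : Set Y, IsOpen U → IsOpen V → U.Nonempty → V.Nonempty → Disjoint U V →
      ∃ g, w g ∉ U ∪ V := by
    intro U V hU hV h1 h2 h3
    obtain ⟨g, hg⟩ := hk U V hU hV
    have := hw g
    rw [hg] at this
    exact ⟨g, this hU hV h1 h2 h3⟩
  have hdense : Dense (range w) := by
    rw [dense_iff_inter_open]
    rintro O hO ⟨x, hx⟩
    obtain ⟨C, ⟨hC1, hC2⟩, hC3⟩ := (closed_nhds_basis x).mem_iff.1 (hO.mem_nhds hx)
    by_cases hV : (Cᶜ).Nonempty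
    · obtain ⟨g, hg⟩ := hw' (interior C) Cᶜ isOpen_interior hC2.isOpen_compl
        ⟨x, mem_interior_iff_mem_nhds.2 hC1⟩ hV
        (disjoint_left.2 fun z hz hz' => hz' (interior_subset hz))
      refine ⟨w g, hC3 ?_, g, rfl⟩
      by_contra h
      exact hg (Or.inr h)
    · rw [not_nonempty_iff_eq_empty, compl_empty_iff] at hV
      obtain ⟨g⟩ := ‹Nonempty J›
      exact ⟨w g, hC3 (hV ▸ mem_univ _), g, rfl⟩
  have hconn : IsPreconnected (range w) := by
    rintro U V hU hV hc ⟨x, -, hx⟩ ⟨y, -, hy⟩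
    by_cases h : (U ∩ V).Nonempty
    · obtain ⟨z, hz, hz'⟩ := hdense.inter_open_nonempty _ (hU.inter hV) h
      exact ⟨z, hz', hz⟩
    · obtain ⟨g, hg⟩ := hw' U V hU hV ⟨x, hx⟩ ⟨y, hy⟩
        (disjoint_iff_inter_eq_empty.2 (not_nonempty_iff_eq_empty.1 h))
      exact absurd (hc ⟨g, rfl⟩) hg
  let τ : TopologicalSpace J := TopologicalSpace.induced w inferInstance
  have hind : IsInducing w := ⟨rfl⟩
  refine ⟨τ, ?_, ?_, ?_⟩
  · have : CompletelyRegularSpace J := hind.completelyRegularSpace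
    have : T0Space J := by
      refine ⟨fun g g' h => ?_⟩
      by_contra hne
      have hi : Inseparable (w g) (w g') := hind.inseparable_iff.2 h
      have hpre : IsPreconnected ({w g, w g'} : Set Y) := by
        rintro U V hU hV hc ⟨x, hx, hxU⟩ ⟨y, hy, hyV⟩
        have e1 : w g ∈ U := by
          rcases hx with rfl | rfl
          · exact hxU
          · exact (hi.mem_open_iff hU).2 hxU
        have e2 : w g ∈ V := by
          rcases hy with rfl | rfl
          · exact hyV
          · exact (hi.mem_open_iff hV).2 hyV
        exact ⟨w g, by simp, e1, e2⟩
      have hd := hK g g' hne _ (hwK g) _ (hwK g') _ hpre (by simp) (by simp)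
      have hall : ∀ y, φ y = φ (w g) := by
        have hcl : IsClosed {y | φ y = φ (w g)} := isClosed_eq hφ continuous_const
        have hs : ({w g, w g'} : Set Y) ⊆ {y | φ y = φ (w g)} := by
          rintro y (rfl | rfl)
          · rfl
          · exact (hi.map hφ).eq.symm
        intro y
        exact (hcl.closure_subset_iff.2 hs) (hd y)
      exact hpq ((hall p).trans (hall q).symm)
    exact {}
  · have : PreconnectedSpace J := by
      refine ⟨hind.isPreconnected_image.1 ?_⟩
      rw [image_univ]; exact hconn
    exact ConnectedSpace.mk ‹_›
  · rintro A ⟨g, hg, g', hg', hne⟩ hA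
    have := hK g g' hne _ (hwK g) _ (hwK g') _ (hind.isPreconnected_image.2 hA)
      ⟨g, hg, rfl⟩ ⟨g', hg', rfl⟩
    rw [dense_iff_closure_eq, hind.closure_eq_preimage_closure_image, this.closure_eq,
      preimage_univ]

section
variable {I : Type u} [LinearOrder I] [SuccOrder I]

noncomputable def hh : List I → Pt I → ℝ
  | [] => fun y => (y.t : ℝ)
  | β :: l => fun y => sg (y.s β) * (hh l y - hh l (a β))

lemma F_list {D : Set I} {f : Pt I → ℝ} (hf : F D f) : ∃ l : List I, hh l = f := by
  induction hf with
  | base D => exact ⟨[], rfl⟩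
  | step D γ f hγ hf ih =>
    obtain ⟨l, rfl⟩ := ih
    exact ⟨γ :: l, rfl⟩

open Cardinal in
lemma F_card [Infinite I] : #{f : Pt I → ℝ // F univ f} ≤ #I := by
  have h : ∀ f : {f : Pt I → ℝ // F univ f}, ∃ l : List I, hh l = f.1 := fun f => F_list f.2
  choose l hl using h
  rw [← mk_list_eq_mk I]
  refine mk_le_of_injective (f := l) fun f g hfg => ?_
  apply Subtype.ext
  rw [← hl f, ← hl g, hfg]

lemma Rel.symm {x y : Pt I} (h : Rel x y) : Rel y x := by
  obtain ⟨α, h⟩ := h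
  exact ⟨α, fun β hβ => (h β hβ).symm⟩

lemma Rel.trans {x y z : Pt I} (h : Rel x y) (h' : Rel y z) : Rel x z := by
  obtain ⟨α, h⟩ := h
  obtain ⟨α', h'⟩ := h'
  exact ⟨max α α', fun β hβ => (h β ((le_max_left _ _).trans hβ)).trans
    (h' β ((le_max_right _ _).trans hβ))⟩

open Classical in
noncomputable def xg (e : I → I) (g : Set I) : Pt I :=
  ⟨0, fun γ => decide (∃ β, succ β = γ ∧ e β ∈ g)⟩

lemma xg_inj [NoMaxOrder I] {e : I → I} (he : ∀ i α, ∃ β ≥ α, e β = i) {g g' : Set I}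
    (h : Rel (xg e g) (xg e g')) : g = g' := by
  obtain ⟨α, h⟩ := h
  ext i
  obtain ⟨β, hβ, rfl⟩ := he i α
  have := h β hβ
  simpa [xg, succ_injective.eq_iff] using this

open Cardinal in
theorem final [NoMaxOrder I] [WellFoundedLT I] [Infinite I] (hI : ∀ α : I, #(Iio α) < #I) :
    ∃ _ : TopologicalSpace (Set I), T35Space (Set I) ∧ WidelyConnectedSpace (Set I) := by
  have he : ∃ e : I → I, ∀ i α, ∃ β ≥ α, e β = i := by
    have : #(I × I) = #I := by rw [mk_prod]; simp
    obtain ⟨ψ⟩ := Cardinal.eq.1 this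
    refine ⟨fun β => (ψ.symm β).1, fun i α => ?_⟩
    by_contra! h
    have h1 : ∀ m, ψ (i, m) ∈ Iio α := by
      intro m
      by_contra hm
      exact h (ψ (i, m)) (not_lt.1 hm) (by simp)
    refine absurd (mk_le_of_injective (f := fun m => (⟨ψ (i, m), h1 m⟩ : Iio α)) ?_)
      (not_le.2 (hI α))
    intro m m' hm
    simpa using hm
  obtain ⟨e, he⟩ := he
  have hop : #(TopologicalSpace.Opens (Sp (univ : Set I))) ≤ 2 ^ #I :=
    opens_card _ (ev_ind univ) (aleph0_le_mk I) F_card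
  have hpair : #(TopologicalSpace.Opens (Sp (univ : Set I)) ×
      TopologicalSpace.Opens (Sp (univ : Set I))) ≤ #(Set I) := by
    rw [mk_set, mk_prod, lift_id]
    refine (mul_le_mul' hop hop).trans ?_
    rw [mul_eq_self]
    exact (aleph0_le_mk I).trans (cantor _).le
  obtain ⟨ι⟩ := hpair
  let k : Set I → Set (Sp (univ : Set I)) × Set (Sp (univ : Set I)) := fun g =>
    ((Function.invFun ι g).1, (Function.invFun ι g).2)
  have : CompletelyRegularSpace (Sp (univ : Set I)) := (ev_ind univ).completelyRegularSpace
  refine core (Y := Sp (univ : Set I)) (fun g => E univ (xg e g))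
    (fun g => E_conn _ fun η _ => conn η) (fun g => E_dense lim_univ _) ?_ k ?_
    _ (cont_F (F.base univ)) ⟨0, fun _ => true⟩ ⟨1, fun _ => true⟩ (by simp)
  · intro g g' hne y hy y' hy' A hA hyA hyA'
    by_contra hd
    exact hne (xg_inj he ((E_rel hy).trans ((rel_of_nondense hA hd hyA hyA').trans
      (E_rel hy').symm)))
  · intro U V hU hV
    refine ⟨ι (⟨U, hU⟩, ⟨V, hV⟩), ?_⟩
    simp only [k, Function.leftInverse_invFun ι.injective _]
    rfl

end

end WC

/-- For every infinite cardinal `κ` there exists a completely regular (Tychonoff)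
widely-connected topological space of cardinality `2 ^ κ`. -/
theorem exists_widely_connected_of_infinite_cardinal (κ : Cardinal.{u})
    (hκ : Cardinal.aleph0 ≤ κ) :
    ∃ (W : Type u) (_ : TopologicalSpace W),
      T35Space W ∧ WidelyConnectedSpace W ∧ Cardinal.mk W = 2 ^ κ := by
  have hcard : Cardinal.mk κ.ord.ToType = κ := by simp
  have : Infinite κ.ord.ToType := by
    rw [Cardinal.infinite_iff, hcard]; exact hκ
  have : NoMaxOrder κ.ord.ToType := Cardinal.noMaxOrder hκ
  let _ : SuccOrder κ.ord.ToType := SuccOrder.ofLinearWellFoundedLT _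
  obtain ⟨τ, h1, h2⟩ := WC.final (I := κ.ord.ToType) (fun α => by
    rw [hcard]; exact Cardinal.mk_Iio_toType_ord_lt α)
  exact ⟨Set κ.ord.ToType, τ, h1, h2, by rw [Cardinal.mk_set, hcard]⟩
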